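/- arXiv:0911.3589 — 7 statements merged into one kernel-verified Lean document; each statement's English description precedes it below -/
import Mathlib

section
/- Boltzmann's H-Theorem: if f : ℝ³ → (0,∞) is measurable and strictly positive, B is measurable and nonnegative, and the function (v, v_*, ω) ↦ B(|v − v_*|, cos θ)(f(v')f(v'_*) + f(v)f(v_*))(|log f(v)| + |log f(v_*)| + |log f(v')| + |log f(v'_*)|) is integrable over ℝ³ × ℝ³ × S², then ∫_{ℝ³} Q(f,f)(v) log(f(v)) dv ≤ 0. -/
open MeasureTheory Metric
open scoped RealInnerProductSpace

noncomputable section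

/-- The surface measure on the unit sphere `S² ⊂ ℝ³`. -/
def sphereMeasure : Measure (Metric.sphere (0 : EuclideanSpace ℝ (Fin 3)) 1) :=
  (volume : Measure (EuclideanSpace ℝ (Fin 3))).toSphere

/-- The Boltzmann collision operator
`Q(f,f)(v) = ∫_{ℝ³} ∫_{S²} B(|v − v_*|, cos θ)[f(v')f(v'_*) − f(v)f(v_*)] dω dv_*`. -/
def collisionOp (B : ℝ → ℝ → ℝ) (f : EuclideanSpace ℝ (Fin 3) → ℝ)
    (v : EuclideanSpace ℝ (Fin 3)) : ℝ :=
  ∫ vs : EuclideanSpace ℝ (Fin 3),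
    ∫ ω : Metric.sphere (0 : EuclideanSpace ℝ (Fin 3)) 1,
      B ‖v - vs‖ (⟪(ω : EuclideanSpace ℝ (Fin 3)), v - vs⟫ / ‖v - vs‖) *
        (f (((1 : ℝ) / 2) • (v + vs + ‖v - vs‖ • (ω : EuclideanSpace ℝ (Fin 3)))) *
            f (((1 : ℝ) / 2) • (v + vs - ‖v - vs‖ • (ω : EuclideanSpace ℝ (Fin 3)))) -
          f v * f vs) ∂sphereMeasure

namespace MeasureTheory

section Polar

variable {E : Type*} [NormedAddCommGroup E] [NormedSpace ℝ E] [MeasurableSpace E] [BorelSpace E]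
  (μ : Measure E)

/-- The measure induced on the unit sphere by a reflection invariant measure is reflection
invariant. -/
theorem measurePreserving_neg_toSphere [μ.IsNegInvariant] :
    MeasurePreserving (fun σ : sphere (0 : E) 1 => -σ) μ.toSphere μ.toSphere := by
  have hm : Measurable (fun σ : sphere (0 : E) 1 => -σ) := continuous_neg.measurable
  refine ⟨hm, Measure.ext fun s hs => ?_⟩
  rw [Measure.map_apply hm hs, μ.toSphere_apply' (hm hs), μ.toSphere_apply' hs]
  have himage : ((↑) '' ((fun σ : sphere (0 : E) 1 => -σ) ⁻¹' s) : Set E) = -((↑) '' s) := by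
    ext x
    simp only [Set.mem_image, Set.mem_preimage, Set.mem_neg]
    constructor
    · rintro ⟨σ, hσ, rfl⟩
      exact ⟨-σ, hσ, rfl⟩
    · rintro ⟨σ, hσ, h⟩
      exact ⟨-σ, by simpa using hσ, by simp [h]⟩
  rw [himage, Set.smul_neg, Measure.measure_neg]

variable [FiniteDimensional ℝ E] [Nontrivial E] [μ.IsAddHaarMeasure]

/-- Polar coordinates `(σ, r) ↦ r • σ` preserve measure. -/
theorem measurePreserving_smul_sphere :
    MeasurePreserving (fun q : sphere (0 : E) 1 × Set.Ioi (0 : ℝ) => (q.2 : ℝ) • (q.1 : E))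
      (μ.toSphere.prod (Measure.volumeIoiPow (Module.finrank ℝ E - 1))) μ := by
  have hpolar := (μ.measurePreserving_homeomorphUnitSphereProd).symm
    (homeomorphUnitSphereProd E).toMeasurableEquiv
  have hcoe := measurePreserving_subtype_coe (μa := μ)
    (measurableSet_singleton (0 : E)).compl
  rw [Measure.restrict_eq_self_of_ae_mem (s := {(0 : E)}ᶜ)
    (compl_mem_ae_iff.2 (measure_singleton 0))] at hcoe
  exact hcoe.comp hpolar

end Polar

section Collision

variable {E : Type*} [NormedAddCommGroup E] [NormedSpace ℝ E]

/-- The first velocity of the collision partners of `(v, v_*)` in direction `ω`. -/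
def collidedFst (p : E × E × sphere (0 : E) 1) : E :=
  ((1 : ℝ) / 2) • (p.1 + p.2.1 + ‖p.1 - p.2.1‖ • (p.2.2 : E))

/-- The second velocity of the collision partners of `(v, v_*)` in direction `ω`. -/
def collidedSnd (p : E × E × sphere (0 : E) 1) : E :=
  ((1 : ℝ) / 2) • (p.1 + p.2.1 - ‖p.1 - p.2.1‖ • (p.2.2 : E))

/-- The change of variables `(V, (σ, r), ω) ↦ (V + (r / 2) σ, V - (r / 2) σ, ω)` describing a pair
of velocities by its mean and the polar coordinates of its difference. -/
def ofMeanPolar (x : E × (sphere (0 : E) 1 × Set.Ioi (0 : ℝ)) × sphere (0 : E) 1) :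
    E × E × sphere (0 : E) 1 :=
  (x.1 + ((1 : ℝ) / 2) • (x.2.1.2 : ℝ) • (x.2.1.1 : E),
    x.1 - ((1 : ℝ) / 2) • (x.2.1.2 : ℝ) • (x.2.1.1 : E), x.2.2)

variable (x : E × (sphere (0 : E) 1 × Set.Ioi (0 : ℝ)) × sphere (0 : E) 1)

theorem ofMeanPolar_sub :
    (ofMeanPolar x).1 - (ofMeanPolar x).2.1 = (x.2.1.2 : ℝ) • (x.2.1.1 : E) := by
  simp only [ofMeanPolar]
  module

theorem norm_ofMeanPolar_sub : ‖(ofMeanPolar x).1 - (ofMeanPolar x).2.1‖ = x.2.1.2 := by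
  rw [ofMeanPolar_sub, norm_smul, norm_eq_of_mem_sphere, mul_one, Real.norm_of_nonneg]
  exact (Set.mem_Ioi.1 x.2.1.2.2).le

theorem collidedFst_ofMeanPolar :
    collidedFst (ofMeanPolar x) = x.1 + ((1 : ℝ) / 2) • (x.2.1.2 : ℝ) • (x.2.2 : E) := by
  rw [collidedFst, norm_ofMeanPolar_sub]
  simp only [ofMeanPolar]
  module

theorem collidedSnd_ofMeanPolar :
    collidedSnd (ofMeanPolar x) = x.1 - ((1 : ℝ) / 2) • (x.2.1.2 : ℝ) • (x.2.2 : E) := by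
  rw [collidedSnd, norm_ofMeanPolar_sub]
  simp only [ofMeanPolar]
  module

variable [MeasurableSpace E] [BorelSpace E] [FiniteDimensional ℝ E]

theorem measurable_collidedFst : Measurable (collidedFst (E := E)) := by
  unfold collidedFst
  fun_prop

theorem measurable_collidedSnd : Measurable (collidedSnd (E := E)) := by
  unfold collidedSnd
  fun_prop

variable (μ : Measure E) [μ.IsAddHaarMeasure]

/-- Passing from mean and difference of a pair of vectors to the pair preserves measure. -/
theorem measurePreserving_add_half_sub_half :
    MeasurePreserving (fun z : E × E => (z.1 + ((1 : ℝ) / 2) • z.2, z.1 - ((1 : ℝ) / 2) • z.2))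
      (μ.prod μ) (μ.prod μ) := by
  have hshift : MeasurePreserving (fun z : E × E => (z.1, z.2 + ((1 : ℝ) / 2) • z.1))
      (μ.prod μ) (μ.prod μ) :=
    (MeasurePreserving.id μ).skew_product (g := fun u V => V + ((1 : ℝ) / 2) • u)
      (by unfold Function.uncurry; fun_prop)
      (Filter.Eventually.of_forall fun u => map_add_right_eq_self μ _)
  have hsub : MeasurePreserving (fun z : E × E => (z.1, z.1 - z.2)) (μ.prod μ) (μ.prod μ) :=
    (MeasurePreserving.id μ).skew_product (g := fun v u => v - u)
      (by unfold Function.uncurry; fun_prop)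
      (Filter.Eventually.of_forall fun v => (Measure.measurePreserving_sub_left μ v).map_eq)
  convert! hsub.comp (Measure.measurePreserving_swap.comp
    (hshift.comp Measure.measurePreserving_swap)) using 1
  ext1 z
  simp only [Function.comp_apply, Prod.swap, Prod.mk.injEq, true_and]
  module

/-- Instance search does not find this product instance by itself. -/
instance instSFinitePolarProd :
    SFinite ((μ.toSphere.prod (Measure.volumeIoiPow (Module.finrank ℝ E - 1))).prod μ.toSphere) :=
  Measure.prod.instSFinite

/-- The change of variables `ofMeanPolar` preserves measure. -/
theorem measurePreserving_ofMeanPolar [Nontrivial E] :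
    MeasurePreserving (ofMeanPolar (E := E))
      (μ.prod ((μ.toSphere.prod (Measure.volumeIoiPow (Module.finrank ℝ E - 1))).prod μ.toSphere))
      (μ.prod (μ.prod μ.toSphere)) := by
  have hpolar := (MeasurePreserving.id μ).prod
    ((measurePreserving_smul_sphere μ).prod (MeasurePreserving.id μ.toSphere))
  have hmean := (measurePreserving_add_half_sub_half μ).prod (MeasurePreserving.id μ.toSphere)
  have hassoc := measurePreserving_prodAssoc μ μ μ.toSphere
  exact hassoc.comp (hmean.comp ((hassoc.symm MeasurableEquiv.prodAssoc).comp hpolar))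

/-- Exchange of the two directions. -/
theorem measurePreserving_exchange_directions :
    MeasurePreserving
      (fun x : E × (sphere (0 : E) 1 × Set.Ioi (0 : ℝ)) × sphere (0 : E) 1 =>
        (x.1, (x.2.2, x.2.1.2), x.2.1.1))
      (μ.prod ((μ.toSphere.prod (Measure.volumeIoiPow (Module.finrank ℝ E - 1))).prod μ.toSphere))
      (μ.prod
        ((μ.toSphere.prod (Measure.volumeIoiPow (Module.finrank ℝ E - 1))).prod μ.toSphere)) := by
  have hassoc := measurePreserving_prodAssoc μ.toSphere
    (Measure.volumeIoiPow (Module.finrank ℝ E - 1)) μ.toSphere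
  have hswap := (Measure.measurePreserving_swap
    (μ := Measure.volumeIoiPow (Module.finrank ℝ E - 1)) (ν := μ.toSphere)).prod
    (MeasurePreserving.id μ.toSphere)
  exact (MeasurePreserving.id μ).prod
    (hswap.comp (Measure.measurePreserving_swap.comp hassoc))

/-- Simultaneous reflection of the two directions. -/
theorem measurePreserving_neg_directions :
    MeasurePreserving
      (fun x : E × (sphere (0 : E) 1 × Set.Ioi (0 : ℝ)) × sphere (0 : E) 1 =>
        (x.1, (-x.2.1.1, x.2.1.2), -x.2.2))
      (μ.prod ((μ.toSphere.prod (Measure.volumeIoiPow (Module.finrank ℝ E - 1))).prod μ.toSphere))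
      (μ.prod
        ((μ.toSphere.prod (Measure.volumeIoiPow (Module.finrank ℝ E - 1))).prod μ.toSphere)) :=
  (MeasurePreserving.id μ).prod
    (((measurePreserving_neg_toSphere μ).prod (MeasurePreserving.id _)).prod
      (measurePreserving_neg_toSphere μ))

end Collision

/-- A measure preserving map leaves integrals and integrability invariant. -/
theorem MeasurePreserving.integrable_and_integral_comp {α β : Type*} [MeasurableSpace α]
    [MeasurableSpace β] {μ : Measure α} {ν : Measure β} {φ : α → β}
    (hφ : MeasurePreserving φ μ ν) {g : β → ℝ} (hg : Integrable g ν) :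
    Integrable (fun x => g (φ x)) μ ∧ ∫ x, g (φ x) ∂μ = ∫ y, g y ∂ν := by
  refine ⟨hφ.integrable_comp_of_integrable hg, ?_⟩
  have hg' := hg.aestronglyMeasurable
  rw [← hφ.map_eq] at hg'
  rw [← integral_map hφ.aemeasurable hg', hφ.map_eq]

/-- The entropy inequality for a reversible exchange of the pairs `(a, b)` and `(c, d)` at
rate `k`. -/
theorem integral_exchange_mul_log_nonpos {X : Type*} [MeasurableSpace X] {ν : Measure X}
    {k a b c d : X → ℝ} (hk : ∀ x, 0 ≤ k x) (ha : ∀ x, 0 < a x) (hb : ∀ x, 0 < b x)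
    (hc : ∀ x, 0 < c x) (hd : ∀ x, 0 < d x) {s t : X → X}
    (hs : MeasurePreserving s ν ν) (ht : MeasurePreserving t ν ν)
    (hks : ∀ x, k (s x) = k x) (has : ∀ x, a (s x) = b x) (hbs : ∀ x, b (s x) = a x)
    (hcs : ∀ x, c (s x) = d x) (hds : ∀ x, d (s x) = c x)
    (hkt : ∀ x, k (t x) = k x) (hat : ∀ x, a (t x) = c x) (hbt : ∀ x, b (t x) = d x)
    (hct : ∀ x, c (t x) = a x) (hdt : ∀ x, d (t x) = b x)
    (hint : Integrable (fun x => k x * (c x * d x - a x * b x) * Real.log (a x)) ν) :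
    ∫ x, k x * (c x * d x - a x * b x) * Real.log (a x) ∂ν ≤ 0 := by
  obtain ⟨hint_b, hb_eq⟩ := hs.integrable_and_integral_comp hint
  obtain ⟨hint_c, hc_eq⟩ := ht.integrable_and_integral_comp hint
  obtain ⟨hint_d, hd_eq⟩ := ht.integrable_and_integral_comp hint_b
  have hsum : ∫ x, (k x * (c x * d x - a x * b x) * Real.log (a x) +
      k (s x) * (c (s x) * d (s x) - a (s x) * b (s x)) * Real.log (a (s x)) +
      (k (t x) * (c (t x) * d (t x) - a (t x) * b (t x)) * Real.log (a (t x)) +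
        k (s (t x)) * (c (s (t x)) * d (s (t x)) - a (s (t x)) * b (s (t x))) *
          Real.log (a (s (t x))))) ∂ν ≤ 0 := by
    refine integral_nonpos fun x => ?_
    simp only [hks, has, hbs, hcs, hds, hkt, hat, hbt, hct, hdt, Pi.zero_apply]
    have hab := mul_pos (ha x) (hb x)
    have hcd := mul_pos (hc x) (hd x)
    have hlog : (c x * d x - a x * b x) *
        (Real.log (a x * b x) - Real.log (c x * d x)) ≤ 0 := by
      rcases le_total (a x * b x) (c x * d x) with h | h
      · exact mul_nonpos_of_nonneg_of_nonpos (sub_nonneg.2 h)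
          (sub_nonpos.2 (Real.log_le_log hab h))
      · exact mul_nonpos_of_nonpos_of_nonneg (sub_nonpos.2 h)
          (sub_nonneg.2 (Real.log_le_log hcd h))
    rw [Real.log_mul (ha x).ne' (hb x).ne', Real.log_mul (hc x).ne' (hd x).ne'] at hlog
    nlinarith [mul_nonpos_of_nonneg_of_nonpos (hk x) hlog]
  have hsplit := integral_add (hint.add hint_b) (hint_c.add hint_d)
  simp only [Pi.add_apply] at hsplit
  rw [hsplit, integral_add hint hint_b, integral_add hint_c hint_d] at hsum
  linarith

/-- Evaluation of a threefold iterated integral with a factor depending on the first variable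
only. -/
theorem integral_iterated_mul_eq {α β γ : Type*} [MeasurableSpace α] [MeasurableSpace β]
    [MeasurableSpace γ] {μ : Measure α} {ν : Measure β} {ρ : Measure γ} [SFinite μ] [SFinite ν]
    [SFinite ρ] {F : α × β × γ → ℝ} {g : α → ℝ}
    (hint : Integrable (fun p => F p * g p.1) (μ.prod (ν.prod ρ))) :
    ∫ x, (∫ y, ∫ z, F (x, y, z) ∂ρ ∂ν) * g x ∂μ = ∫ p, F p * g p.1 ∂(μ.prod (ν.prod ρ)) := by
  rw [integral_prod _ hint]
  refine integral_congr_ae ?_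
  filter_upwards [hint.prod_right_ae] with x hx
  rw [integral_prod _ hx]
  simp only [integral_mul_const]

end MeasureTheory

/-- **Boltzmann's H-Theorem**: if `f` is measurable and strictly positive, `B` is measurable
and nonnegative, and the symmetrized integrand is integrable over `ℝ³ × ℝ³ × S²`, then
`∫ Q(f,f)(v) log f(v) dv ≤ 0`. -/
theorem H_theorem
    (f : EuclideanSpace ℝ (Fin 3) → ℝ) (hfm : Measurable f) (hfpos : ∀ v, 0 < f v)
    (B : ℝ → ℝ → ℝ) (hBmeas : Measurable (Function.uncurry B))
    (hBnonneg : ∀ x y, 0 ≤ B x y)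
    (hint : Integrable
      (fun p : EuclideanSpace ℝ (Fin 3) × EuclideanSpace ℝ (Fin 3) ×
          Metric.sphere (0 : EuclideanSpace ℝ (Fin 3)) 1 =>
        B ‖p.1 - p.2.1‖ (⟪(p.2.2 : EuclideanSpace ℝ (Fin 3)), p.1 - p.2.1⟫ / ‖p.1 - p.2.1‖) *
          (f (((1 : ℝ) / 2) • (p.1 + p.2.1 + ‖p.1 - p.2.1‖ • (p.2.2 : EuclideanSpace ℝ (Fin 3)))) *
              f (((1 : ℝ) / 2) • (p.1 + p.2.1 - ‖p.1 - p.2.1‖ • (p.2.2 : EuclideanSpace ℝ (Fin 3)))) +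
            f p.1 * f p.2.1) *
          (|Real.log (f p.1)| + |Real.log (f p.2.1)| +
            |Real.log (f (((1 : ℝ) / 2) •
                (p.1 + p.2.1 + ‖p.1 - p.2.1‖ • (p.2.2 : EuclideanSpace ℝ (Fin 3)))))| +
            |Real.log (f (((1 : ℝ) / 2) •
                (p.1 + p.2.1 - ‖p.1 - p.2.1‖ • (p.2.2 : EuclideanSpace ℝ (Fin 3)))))|))
      ((volume : Measure (EuclideanSpace ℝ (Fin 3))).prod
        ((volume : Measure (EuclideanSpace ℝ (Fin 3))).prod sphereMeasure))) :
    (∫ v : EuclideanSpace ℝ (Fin 3), collisionOp B f v * Real.log (f v)) ≤ 0 := by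
  set k : EuclideanSpace ℝ (Fin 3) × EuclideanSpace ℝ (Fin 3) ×
      sphere (0 : EuclideanSpace ℝ (Fin 3)) 1 → ℝ := fun p =>
    B ‖p.1 - p.2.1‖ (⟪(p.2.2 : EuclideanSpace ℝ (Fin 3)), p.1 - p.2.1⟫ / ‖p.1 - p.2.1‖) with hk
  have hk_nonneg : ∀ p, 0 ≤ k p := fun p => hBnonneg _ _
  have hkm : Measurable k :=
    hBmeas.comp (f := fun p : EuclideanSpace ℝ (Fin 3) × EuclideanSpace ℝ (Fin 3) ×
      sphere (0 : EuclideanSpace ℝ (Fin 3)) 1 =>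
      (‖p.1 - p.2.1‖, ⟪(p.2.2 : EuclideanSpace ℝ (Fin 3)), p.1 - p.2.1⟫ / ‖p.1 - p.2.1‖))
      (by fun_prop)
  have hfst := measurable_collidedFst (E := EuclideanSpace ℝ (Fin 3))
  have hsnd := measurable_collidedSnd (E := EuclideanSpace ℝ (Fin 3))
  have : SFinite sphereMeasure := by
    unfold sphereMeasure
    infer_instance
  have hW : Integrable (fun p : EuclideanSpace ℝ (Fin 3) × EuclideanSpace ℝ (Fin 3) ×
      sphere (0 : EuclideanSpace ℝ (Fin 3)) 1 =>
      k p * (f (collidedFst p) * f (collidedSnd p) - f p.1 * f p.2.1) * Real.log (f p.1))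
      ((volume : Measure (EuclideanSpace ℝ (Fin 3))).prod
        ((volume : Measure (EuclideanSpace ℝ (Fin 3))).prod sphereMeasure)) := by
    refine hint.mono' (by fun_prop) (Filter.Eventually.of_forall fun p => ?_)
    have hc := mul_pos (hfpos (collidedFst p)) (hfpos (collidedSnd p))
    have ha := mul_pos (hfpos p.1) (hfpos p.2.1)
    rw [Real.norm_eq_abs, abs_mul, abs_mul, abs_of_nonneg (hk_nonneg p)]
    refine mul_le_mul (mul_le_mul_of_nonneg_left ?_ (hk_nonneg p)) ?_ (abs_nonneg _)
      (mul_nonneg (hk_nonneg p) (add_pos hc ha).le)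
    · change _ ≤ f (collidedFst p) * f (collidedSnd p) + f p.1 * f p.2.1
      exact abs_le.2 ⟨by linarith, by linarith⟩
    · refine le_add_of_le_of_nonneg (le_add_of_le_of_nonneg
        (le_add_of_nonneg_right (abs_nonneg _)) (abs_nonneg _)) (abs_nonneg _)
  calc ∫ v, collisionOp B f v * Real.log (f v)
      = ∫ p, k p * (f (collidedFst p) * f (collidedSnd p) - f p.1 * f p.2.1) * Real.log (f p.1)
          ∂((volume : Measure (EuclideanSpace ℝ (Fin 3))).prod
            ((volume : Measure (EuclideanSpace ℝ (Fin 3))).prod sphereMeasure)) :=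
        integral_iterated_mul_eq (g := fun v => Real.log (f v)) hW
    _ ≤ 0 := by
      obtain ⟨hint', heq⟩ := (measurePreserving_ofMeanPolar
        (volume : Measure (EuclideanSpace ℝ (Fin 3)))).integrable_and_integral_comp hW
      have hcos : ∀ x, k (ofMeanPolar x) = B x.2.1.2
          ⟪(x.2.2 : EuclideanSpace ℝ (Fin 3)), (x.2.1.1 : EuclideanSpace ℝ (Fin 3))⟫ := by
        intro x
        have hr : (x.2.1.2 : ℝ) ≠ 0 := (Set.mem_Ioi.1 x.2.1.2.2).ne'
        simp only [hk, norm_ofMeanPolar_sub]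
        rw [ofMeanPolar_sub, real_inner_smul_right]
        congr 1
        exact mul_div_cancel_left₀ _ hr
      refine heq.symm.le.trans (integral_exchange_mul_log_nonpos (fun x => hk_nonneg _)
        (fun x => hfpos _) (fun x => hfpos _) (fun x => hfpos _) (fun x => hfpos _)
        (measurePreserving_neg_directions _) (measurePreserving_exchange_directions _)
        ?_ ?_ ?_ ?_ ?_ ?_ ?_ ?_ ?_ ?_ hint') <;>
      intro x <;>
      (try simp only [hcos, collidedFst_ofMeanPolar, collidedSnd_ofMeanPolar]) <;>
      simp [ofMeanPolar, sub_eq_add_neg, real_inner_comm]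

end
end

section
/- Compact support of the collision operator (Proposition 4, part 1): if f : ℝ³ → ℝ is measurable and supp(f) ⊆ B(0, R) (the closed ball of radius R > 0 centered at the origin), and B is measurable and nonnegative, then Q(f,f)(v) = 0 for every v with |v| > √2·R; i.e. supp(Q(f,f)) ⊆ B(0, √2·R). -/
open MeasureTheory Metric
open scoped RealInnerProductSpace

noncomputable section

/-- Conservation of energy: the pre-collision velocities carry the energy of the pair `(v, vs)`. -/
theorem norm_sq_add_norm_sq_preCollision {E : Type*} [NormedAddCommGroup E]
    [InnerProductSpace ℝ E] (v vs ω : E) (hω : ‖ω‖ = 1) :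
    ‖((1 : ℝ) / 2) • (v + vs + ‖v - vs‖ • ω)‖ ^ 2 +
      ‖((1 : ℝ) / 2) • (v + vs - ‖v - vs‖ • ω)‖ ^ 2 = ‖v‖ ^ 2 + ‖vs‖ ^ 2 := by
  have h₁ := parallelogram_law_with_norm ℝ (v + vs) (‖v - vs‖ • ω)
  have h₂ := parallelogram_law_with_norm ℝ v vs
  have h₃ : ‖‖v - vs‖ • ω‖ = ‖v - vs‖ := by rw [norm_smul, norm_norm, hω, mul_one]
  rw [h₃] at h₁
  rw [norm_smul, norm_smul, Real.norm_of_nonneg (by norm_num : (0 : ℝ) ≤ 1 / 2)]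
  linarith

/-- **Compact support of the collision operator** (Proposition 4, part 1): if
`supp f ⊆ B(0, R)` then `Q(f,f)(v) = 0` whenever `|v| > √2 R`, i.e.
`supp Q(f,f) ⊆ B(0, √2 R)`. -/
theorem collisionOp_support
    (R : ℝ) (hR : 0 < R)
    (f : EuclideanSpace ℝ (Fin 3) → ℝ) (hfm : Measurable f)
    (hfsupp : Function.support f ⊆ Metric.closedBall (0 : EuclideanSpace ℝ (Fin 3)) R)
    (B : ℝ → ℝ → ℝ) (hBmeas : Measurable (Function.uncurry B))
    (hBnonneg : ∀ x y, 0 ≤ B x y) :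
    (∀ v : EuclideanSpace ℝ (Fin 3), Real.sqrt 2 * R < ‖v‖ → collisionOp B f v = 0) ∧
    Function.support (collisionOp B f) ⊆
      Metric.closedBall (0 : EuclideanSpace ℝ (Fin 3)) (Real.sqrt 2 * R) := by
  have hzero : ∀ w, R < ‖w‖ → f w = 0 := fun w hw => by
    by_contra h
    exact hw.not_ge (mem_closedBall_zero_iff.1 (hfsupp h))
  have hQ : ∀ v, Real.sqrt 2 * R < ‖v‖ → collisionOp B f v = 0 := by
    intro v hv
    have hsq : 2 * R ^ 2 < ‖v‖ ^ 2 := by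
      have h := pow_lt_pow_left₀ hv (by positivity) two_ne_zero
      rwa [mul_pow, Real.sq_sqrt zero_le_two] at h
    have hfv : f v = 0 := hzero v (lt_of_pow_lt_pow_left₀ 2 (norm_nonneg v) (by nlinarith))
    have hgain : ∀ (vs : EuclideanSpace ℝ (Fin 3))
        (ω : Metric.sphere (0 : EuclideanSpace ℝ (Fin 3)) 1),
        f (((1 : ℝ) / 2) • (v + vs + ‖v - vs‖ • (ω : EuclideanSpace ℝ (Fin 3)))) *
          f (((1 : ℝ) / 2) • (v + vs - ‖v - vs‖ • (ω : EuclideanSpace ℝ (Fin 3)))) = 0 := by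
      intro vs ω
      have henergy := norm_sq_add_norm_sq_preCollision v vs ω (mem_sphere_zero_iff_norm.1 ω.2)
      rcases lt_or_ge R
        ‖((1 : ℝ) / 2) • (v + vs + ‖v - vs‖ • (ω : EuclideanSpace ℝ (Fin 3)))‖ with h₁ | h₁
      · rw [hzero _ h₁, zero_mul]
      rcases lt_or_ge R
        ‖((1 : ℝ) / 2) • (v + vs - ‖v - vs‖ • (ω : EuclideanSpace ℝ (Fin 3)))‖ with h₂ | h₂
      · rw [hzero _ h₂, mul_zero]
      have h₃ := pow_le_pow_left₀ (norm_nonneg _) h₁ 2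
      have h₄ := pow_le_pow_left₀ (norm_nonneg _) h₂ 2
      linarith [sq_nonneg ‖vs‖]
    simp only [collisionOp, hgain, hfv, zero_mul, sub_zero, mul_zero, integral_zero]
  refine ⟨hQ, fun v hv => mem_closedBall_zero_iff.2 ?_⟩
  by_contra! h
  exact hv (hQ v h)

end
end

section
/- Ibragimov–Rjasanow substitution identity for the gain term: if f : ℝ³ → [0,∞) is continuous with compact support and B : [0,∞) × [−1,1] → [0,∞) is continuous, then the gain term Q⁺(f,f)(v) = ∫_{ℝ³} ∫_{S²} B(|v − v_*|, cos θ) f(v') f(v'_*) dω dv_* equals 8 ∫_{ℝ³} ∫_{S²} B(2|u|, ω·u/|u|) f(v − |u|ω + u) f(v − |u|ω − u) dω du for every v ∈ ℝ³. -/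
open MeasureTheory Metric
open scoped RealInnerProductSpace

noncomputable section

/-- The gain part of the Boltzmann collision operator,
`Q⁺(f,f)(v) = ∫_{ℝ³} ∫_{S²} B(|v − v_*|, cos θ) f(v') f(v'_*) dω dv_*`. -/
def gainTerm (B : ℝ → ℝ → ℝ) (f : EuclideanSpace ℝ (Fin 3) → ℝ)
    (v : EuclideanSpace ℝ (Fin 3)) : ℝ :=
  ∫ vs : EuclideanSpace ℝ (Fin 3),
    ∫ ω : Metric.sphere (0 : EuclideanSpace ℝ (Fin 3)) 1,
      B ‖v - vs‖ (⟪(ω : EuclideanSpace ℝ (Fin 3)), v - vs⟫ / ‖v - vs‖) *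
        (f (((1 : ℝ) / 2) • (v + vs + ‖v - vs‖ • (ω : EuclideanSpace ℝ (Fin 3)))) *
          f (((1 : ℝ) / 2) • (v + vs - ‖v - vs‖ • (ω : EuclideanSpace ℝ (Fin 3)))))
        ∂sphereMeasure

section Polar

variable {E : Type*} [NormedAddCommGroup E] [NormedSpace ℝ E] [FiniteDimensional ℝ E]
  [MeasurableSpace E] [BorelSpace E] (μ : Measure E) [μ.IsAddHaarMeasure]

/-- A continuous function that vanishes for large radii is integrable in polar coordinates. -/
theorem integrable_sphere_prod_sphere {H : ℝ → sphere (0 : E) 1 → sphere (0 : E) 1 → ℝ}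
    (hH : Continuous fun p : ℝ × sphere (0 : E) 1 × sphere (0 : E) 1 => H p.1 p.2.1 p.2.2)
    {R : ℝ} (hR : ∀ r, R < r → ∀ η ω, H r η ω = 0) (n : ℕ) :
    Integrable (fun p : (sphere (0 : E) 1 × Set.Ioi (0 : ℝ)) × sphere (0 : E) 1 =>
      H p.1.2 p.1.1 p.2) ((μ.toSphere.prod (.volumeIoiPow n)).prod μ.toSphere) := by
  have hpos : (0 : ℝ) < max R 0 + 1 := by positivity
  set ρ : Set.Ioi (0 : ℝ) := ⟨max R 0 + 1, hpos⟩
  set s : Set ((sphere (0 : E) 1 × Set.Ioi (0 : ℝ)) × sphere (0 : E) 1) :=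
    (Set.univ ×ˢ Set.Iio ρ) ×ˢ Set.univ with hs
  have hsm : MeasurableSet s := (MeasurableSet.univ.prod measurableSet_Iio).prod MeasurableSet.univ
  have hsupp : Function.support (fun p : (sphere (0 : E) 1 × Set.Ioi (0 : ℝ)) × sphere (0 : E) 1 =>
      H p.1.2 p.1.1 p.2) ⊆ s := by
    intro p hp
    simp only [hs, Set.mem_prod, Set.mem_univ, Set.mem_Iio, true_and, and_true]
    by_contra hlt
    refine hp (hR _ ?_ _ _)
    have h : max R 0 + 1 ≤ (p.1.2 : ℝ) := not_lt.1 hlt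
    linarith [le_max_left R 0]
  obtain ⟨C, hC⟩ := ((isCompact_Icc (a := (0 : ℝ)) (b := max R 0 + 1)).prod
    (isCompact_univ (X := sphere (0 : E) 1 × sphere (0 : E) 1))).exists_bound_of_continuousOn
    hH.continuousOn
  rw [← integrableOn_iff_integrable_of_support_subset hsupp]
  refine Measure.integrableOn_of_bounded (M := C) ?_ ?_ ?_
  · rw [hs, Measure.prod_prod, Measure.prod_prod, Measure.volumeIoiPow_apply_Iio]
    finiteness
  · exact (hH.comp (g := fun p : ℝ × sphere (0 : E) 1 × sphere (0 : E) 1 => H p.1 p.2.1 p.2.2)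
      (f := fun p : (sphere (0 : E) 1 × Set.Ioi (0 : ℝ)) × sphere (0 : E) 1 =>
        ((p.1.2 : ℝ), p.1.1, p.2)) (by fun_prop)).aestronglyMeasurable
  · filter_upwards [ae_restrict_mem hsm] with p hp
    have h : (p.1.2 : ℝ) < max R 0 + 1 := hp.1.2
    exact hC ((p.1.2 : ℝ), p.1.1, p.2) ⟨⟨p.1.2.2.le, h.le⟩, Set.mem_univ _⟩

/-- Integration in polar coordinates. -/
theorem integral_eq_integral_sphere_prod [Nontrivial E] (F : E → ℝ) :
    ∫ u, F u ∂μ = ∫ p : sphere (0 : E) 1 × Set.Ioi (0 : ℝ), F ((p.2 : ℝ) • (p.1 : E))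
      ∂μ.toSphere.prod (.volumeIoiPow (Module.finrank ℝ E - 1)) := by
  rw [← μ.measurePreserving_homeomorphUnitSphereProd.integral_comp
    (Homeomorph.measurableEmbedding _)]
  calc
    ∫ u, F u ∂μ = ∫ x : ({(0)}ᶜ : Set E), F x ∂(μ.comap (↑)) := by
      rw [integral_subtype_comap (measurableSet_singleton _).compl F,
        restrict_compl_singleton]
    _ = _ := by
      refine integral_congr_ae (.of_forall fun x => ?_)
      have hx : ‖(x : E)‖ ≠ 0 := norm_ne_zero_iff.2 x.2
      simp [smul_smul, hx]

/-- The angular part of the integration variable can be exchanged with a free sphere variable. -/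
theorem integral_integral_sphere_swap [Nontrivial E] {F G : E → sphere (0 : E) 1 → ℝ}
    {H : ℝ → sphere (0 : E) 1 → sphere (0 : E) 1 → ℝ}
    (hH : Continuous fun p : ℝ × sphere (0 : E) 1 × sphere (0 : E) 1 => H p.1 p.2.1 p.2.2)
    {R : ℝ} (hR : ∀ r, R < r → ∀ η ω, H r η ω = 0)
    (hF : ∀ r, 0 < r → ∀ η ω : sphere (0 : E) 1, F (r • (η : E)) ω = H r η ω)
    (hG : ∀ r, 0 < r → ∀ η ω : sphere (0 : E) 1, G (r • (η : E)) ω = H r ω η) :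
    ∫ u, ∫ ω, F u ω ∂μ.toSphere ∂μ = ∫ u, ∫ ω, G u ω ∂μ.toSphere ∂μ := by
  have hH' : Continuous fun p : ℝ × sphere (0 : E) 1 × sphere (0 : E) 1 => H p.1 p.2.2 p.2.1 :=
    hH.comp (g := fun p : ℝ × sphere (0 : E) 1 × sphere (0 : E) 1 => H p.1 p.2.1 p.2.2)
      (f := fun p : ℝ × sphere (0 : E) 1 × sphere (0 : E) 1 => (p.1, p.2.2, p.2.1)) (by fun_prop)
  have hint := (integrable_sphere_prod_sphere μ hH hR
    (Module.finrank ℝ E - 1)).integral_prod_left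
  have hint' := (integrable_sphere_prod_sphere μ (H := fun r η ω => H r ω η) hH'
    (fun r hr η ω => hR r hr ω η) (Module.finrank ℝ E - 1)).integral_prod_left
  rw [integral_eq_integral_sphere_prod μ fun u => ∫ ω, F u ω ∂μ.toSphere,
    integral_eq_integral_sphere_prod μ fun u => ∫ ω, G u ω ∂μ.toSphere]
  have hF' : ∀ (r : Set.Ioi (0 : ℝ)) (η ω : sphere (0 : E) 1),
      F ((r : ℝ) • (η : E)) ω = H r η ω := fun r => hF r r.2
  have hG' : ∀ (r : Set.Ioi (0 : ℝ)) (η ω : sphere (0 : E) 1),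
      G ((r : ℝ) • (η : E)) ω = H r ω η := fun r => hG r r.2
  simp only [hF', hG']
  rw [integral_prod_symm _ hint, integral_prod_symm _ hint']
  refine integral_congr_ae (.of_forall fun r => integral_integral_swap ?_)
  have hc : Continuous (Function.uncurry fun η ω : sphere (0 : E) 1 => H r η ω) :=
    hH.comp (g := fun p : ℝ × sphere (0 : E) 1 × sphere (0 : E) 1 => H p.1 p.2.1 p.2.2)
      (f := fun p : sphere (0 : E) 1 × sphere (0 : E) 1 => ((r : ℝ), p.1, p.2)) (by fun_prop)
  exact hc.integrable_of_hasCompactSupport (.of_compactSpace _)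

end Polar

/-- **Ibragimov–Rjasanow substitution identity for the gain term**: for continuous,
compactly supported, nonnegative `f` and continuous nonnegative `B`,
`Q⁺(f,f)(v) = 8 ∫_{ℝ³} ∫_{S²} B(2|u|, ω·u/|u|) f(v − |u|ω + u) f(v − |u|ω − u) dω du`. -/
theorem gainTerm_substitution
    (f : EuclideanSpace ℝ (Fin 3) → ℝ) (hfc : Continuous f)
    (hfsupp : HasCompactSupport f) (hfnonneg : ∀ v, 0 ≤ f v)
    (B : ℝ → ℝ → ℝ) (hBc : Continuous (Function.uncurry B))
    (hBnonneg : ∀ x y, 0 ≤ B x y) :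
    ∀ v : EuclideanSpace ℝ (Fin 3),
      gainTerm B f v =
        8 * ∫ u : EuclideanSpace ℝ (Fin 3),
          ∫ ω : Metric.sphere (0 : EuclideanSpace ℝ (Fin 3)) 1,
            B (2 * ‖u‖) (⟪(ω : EuclideanSpace ℝ (Fin 3)), u⟫ / ‖u‖) *
              (f (v - ‖u‖ • (ω : EuclideanSpace ℝ (Fin 3)) + u) *
                f (v - ‖u‖ • (ω : EuclideanSpace ℝ (Fin 3)) - u)) ∂sphereMeasure := by
  intro v
  set S := sphere (0 : EuclideanSpace ℝ (Fin 3)) 1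
  obtain ⟨R, hR⟩ := hfsupp.isCompact.isBounded.exists_norm_le
  have hvanish : ∀ x, R < ‖x‖ → f x = 0 := fun x hx =>
    image_eq_zero_of_notMem_tsupport fun h => (hR x h).not_gt hx
  have hsubst : gainTerm B f v = 8 * ∫ w : EuclideanSpace ℝ (Fin 3), ∫ ω : S,
      B (2 * ‖w‖) (⟪(ω : EuclideanSpace ℝ (Fin 3)), w⟫ / ‖w‖) *
        (f (v - w + ‖w‖ • (ω : EuclideanSpace ℝ (Fin 3))) *
          f (v - w - ‖w‖ • (ω : EuclideanSpace ℝ (Fin 3)))) ∂sphereMeasure := by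
    rw [gainTerm, ← integral_sub_left_eq_self _ volume v]
    have h := Measure.integral_comp_smul (volume : Measure (EuclideanSpace ℝ (Fin 3)))
      (fun x : EuclideanSpace ℝ (Fin 3) => ∫ ω : S,
        B ‖v - (v - x)‖ (⟪(ω : EuclideanSpace ℝ (Fin 3)), v - (v - x)⟫ / ‖v - (v - x)‖) *
        (f (((1 : ℝ) / 2) • (v + (v - x) + ‖v - (v - x)‖ • (ω : EuclideanSpace ℝ (Fin 3)))) *
          f (((1 : ℝ) / 2) • (v + (v - x) - ‖v - (v - x)‖ • (ω : EuclideanSpace ℝ (Fin 3)))))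
        ∂sphereMeasure) (2 : ℝ)
    have h8 : |((2 : ℝ) ^ Module.finrank ℝ (EuclideanSpace ℝ (Fin 3)))⁻¹| = 8⁻¹ := by
      rw [finrank_euclideanSpace_fin]; norm_num
    rw [h8, smul_eq_mul, eq_inv_mul_iff_mul_eq₀ (by norm_num)] at h
    rw [← h]
    congr 1
    refine integral_congr_ae (.of_forall fun w => integral_congr_ae (.of_forall fun ω => ?_))
    have hn : ‖(2 : ℝ) • w‖ = 2 * ‖w‖ := by simp [norm_smul]
    simp only [sub_sub_cancel, hn, inner_smul_right]
    rw [mul_div_mul_left _ _ two_ne_zero]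
    congr 3 <;> module
  rw [hsubst]
  congr 1
  refine integral_integral_sphere_swap volume
    (H := fun r η ω => B (2 * r) ⟪(ω : EuclideanSpace ℝ (Fin 3)), (η : EuclideanSpace ℝ (Fin 3))⟫ *
      (f (v - r • (η : EuclideanSpace ℝ (Fin 3)) + r • (ω : EuclideanSpace ℝ (Fin 3))) *
        f (v - r • (η : EuclideanSpace ℝ (Fin 3)) - r • (ω : EuclideanSpace ℝ (Fin 3)))))
    (R := ‖v‖ + R) ?_ ?_ ?_ ?_
  · refine Continuous.mul (hBc.comp (Continuous.prodMk (by fun_prop) (by fun_prop))) (by fun_prop)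
  · intro r hr η ω
    rcases lt_or_ge R
      ‖v - r • (η : EuclideanSpace ℝ (Fin 3)) + r • (ω : EuclideanSpace ℝ (Fin 3))‖ with h | h
    · simp [hvanish _ h]
    rcases lt_or_ge R
      ‖v - r • (η : EuclideanSpace ℝ (Fin 3)) - r • (ω : EuclideanSpace ℝ (Fin 3))‖ with h' | h'
    · simp [hvanish _ h']
    exfalso
    have hη : ‖(η : EuclideanSpace ℝ (Fin 3))‖ = 1 := norm_eq_of_mem_sphere η
    have hrη : r ≤ ‖r • (η : EuclideanSpace ℝ (Fin 3))‖ := by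
      rw [norm_smul, hη, mul_one]; exact le_abs_self r
    have h2 : (2 : ℝ) • (r • (η : EuclideanSpace ℝ (Fin 3))) = (2 : ℝ) • v -
        ((v - r • (η : EuclideanSpace ℝ (Fin 3)) + r • (ω : EuclideanSpace ℝ (Fin 3))) +
          (v - r • (η : EuclideanSpace ℝ (Fin 3)) - r • (ω : EuclideanSpace ℝ (Fin 3)))) := by
      module
    have h3 := (congrArg norm h2).trans_le ((norm_sub_le _ _).trans
      (add_le_add_right (norm_add_le _ _) _))
    rw [norm_smul (2 : ℝ) v, norm_smul (2 : ℝ), Real.norm_two] at h3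
    linarith
  · intro r hr η ω
    have hn : ‖r • (η : EuclideanSpace ℝ (Fin 3))‖ = r := by
      rw [norm_smul, norm_eq_of_mem_sphere η, mul_one, Real.norm_of_nonneg hr.le]
    simp only [hn, inner_smul_right, mul_div_cancel_left₀ _ hr.ne']
  · intro r hr η ω
    have hn : ‖r • (η : EuclideanSpace ℝ (Fin 3))‖ = r := by
      rw [norm_smul, norm_eq_of_mem_sphere η, mul_one, Real.norm_of_nonneg hr.le]
    simp only [hn, inner_smul_right, mul_div_cancel_left₀ _ hr.ne']
    rw [real_inner_comm]

end
end

section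
/- Discrete conservation of the mean Jacobian for Arakawa's scheme: let n ≥ 1, h > 0, and let f, ψ : (ℤ/nℤ) × (ℤ/nℤ) → ℝ be grid functions on the doubly periodic grid. Define 𝕁^{++}_{i,j}(f,ψ) = (1/(4h²))[(f_{i+1,j} − f_{i−1,j})(ψ_{i,j+1} − ψ_{i,j−1}) − (f_{i,j+1} − f_{i,j−1})(ψ_{i+1,j} − ψ_{i−1,j})]. Then Σ_{i,j} 𝕁^{++}_{i,j}(f,ψ) = 0, where the sum ranges over all grid points. -/
/-- On a finite abelian group, the centered Jacobian in the directions `a` and `b`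
has vanishing sum. -/
theorem sum_centered_jacobian_eq_zero {G R : Type*} [AddCommGroup G] [Fintype G] [CommRing R]
    (f ψ : G → R) (a b : G) :
    ∑ p, ((f (p + a) - f (p - a)) * (ψ (p + b) - ψ (p - b)) -
      (f (p + b) - f (p - b)) * (ψ (p + a) - ψ (p - a))) = 0 := by
  have shift (g : G → R) (c : G) : ∑ p, g (p + c) = ∑ p, g p :=
    Equiv.sum_comp (Equiv.addRight c) g
  have hNE := shift (fun p => f (p - b) * ψ (p - a)) (a + b)
  have hSE := shift (fun p => f (p + b) * ψ (p - a)) (a - b)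
  have hNW := shift (fun p => f (p - b) * ψ (p + a)) (b - a)
  have hSW := shift (fun p => f (p + b) * ψ (p + a)) (-a - b)
  have e₁ (p : G) : p + (a + b) - b = p + a := by abel
  have e₂ (p : G) : p + (a + b) - a = p + b := by abel
  have e₃ (p : G) : p + (a - b) + b = p + a := by abel
  have e₄ (p : G) : p + (a - b) - a = p - b := by abel
  have e₅ (p : G) : p + (b - a) - b = p - a := by abel
  have e₆ (p : G) : p + (b - a) + a = p + b := by abel
  have e₇ (p : G) : p + (-a - b) + b = p - a := by abel
  have e₈ (p : G) : p + (-a - b) + a = p - b := by abel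
  simp only [e₁, e₂, e₃, e₄, e₅, e₆, e₇, e₈] at hNE hSE hNW hSW
  simp only [sub_mul, mul_sub, Finset.sum_sub_distrib]
  linear_combination hNE - hSE - hNW + hSW

/-- **Discrete conservation of the mean Jacobian for Arakawa's scheme**: on the doubly
periodic `n × n` grid, the sum over all grid points of Arakawa's centered Jacobian
approximation `𝕁^{++}` vanishes. -/
theorem arakawa_mean_jacobian_conservation
    (n : ℕ) [NeZero n] (h : ℝ) (hh : 0 < h)
    (f ψ : ZMod n × ZMod n → ℝ) :
    ∑ i : ZMod n, ∑ j : ZMod n,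
      (1 / (4 * h ^ 2)) *
        ((f (i + 1, j) - f (i - 1, j)) * (ψ (i, j + 1) - ψ (i, j - 1)) -
          (f (i, j + 1) - f (i, j - 1)) * (ψ (i + 1, j) - ψ (i - 1, j))) = 0 := by
  simp_rw [← Finset.mul_sum]
  have key := sum_centered_jacobian_eq_zero f ψ ((1, 0) : ZMod n × ZMod n) (0, 1)
  simp only [Prod.mk_add_mk, Prod.mk_sub_mk, Fintype.sum_prod_type, add_zero,
    sub_zero] at key
  rw [key, mul_zero]
end

section
/- Positivity of the time-relaxed (TR) scheme (Proposition 9, part 3): let P be a bilinear map on real-valued functions on ℝ³ such that P(u, w)(v) ≥ 0 for all v whenever u ≥ 0 and w ≥ 0 pointwise; let μ > 0, let m ≥ 0 be an integer, let τ ∈ [0, 1], let f⁰ ≥ 0 and f_∞ ≥ 0 be nonnegative functions, and define φ₀ = f⁰ and recursively φ_{k+1} = (1/(k+1)) Σ_{l=0}^{k} (1/μ) P(φ_l, φ_{k−l}). Then the TR update f¹ = (1 − τ) Σ_{k=0}^{m} τ^k φ_k + τ^{m+1} f_∞ is nonnegative pointwise. -/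
/-- **Positivity of the time-relaxed (TR) scheme** (Proposition 9, part 3): if the
bilinear operator `P` maps pairs of nonnegative functions to nonnegative functions,
`μ > 0`, `τ ∈ [0,1]`, `f⁰ ≥ 0` and `f_∞ ≥ 0`, and `φ₀ = f⁰`,
`φ_{k+1} = (1/(k+1)) Σ_{l=0}^{k} (1/μ) P(φ_l, φ_{k−l})`, then the TR update
`f¹ = (1 − τ) Σ_{k=0}^{m} τ^k φ_k + τ^{m+1} f_∞` is nonnegative pointwise. -/
theorem time_relaxed_positivity
    (P : (EuclideanSpace ℝ (Fin 3) → ℝ) →ₗ[ℝ] (EuclideanSpace ℝ (Fin 3) → ℝ) →ₗ[ℝ]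
      (EuclideanSpace ℝ (Fin 3) → ℝ))
    (hP : ∀ u w : EuclideanSpace ℝ (Fin 3) → ℝ,
      (∀ v, 0 ≤ u v) → (∀ v, 0 ≤ w v) → ∀ v, 0 ≤ P u w v)
    (μ : ℝ) (hμ : 0 < μ) (m : ℕ) (τ : ℝ) (hτ : τ ∈ Set.Icc (0 : ℝ) 1)
    (f0 finf : EuclideanSpace ℝ (Fin 3) → ℝ)
    (hf0 : ∀ v, 0 ≤ f0 v) (hfinf : ∀ v, 0 ≤ finf v)
    (φ : ℕ → EuclideanSpace ℝ (Fin 3) → ℝ) (hφ0 : φ 0 = f0)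
    (hφ : ∀ k : ℕ, φ (k + 1) = fun v =>
      (1 / ((k : ℝ) + 1)) * ∑ l ∈ Finset.range (k + 1), (1 / μ) * P (φ l) (φ (k - l)) v) :
    ∀ v, 0 ≤ (1 - τ) * (∑ k ∈ Finset.range (m + 1), τ ^ k * φ k v) + τ ^ (m + 1) * finf v := by
  have φ_nonneg : ∀ k v, 0 ≤ φ k v := by
    intro k
    induction k using Nat.strong_induction_on with
    | _ k ih =>
      intro v
      cases k with
      | zero => exact hφ0 ▸ hf0 v
      | succ k =>
        rw [hφ k]
        refine mul_nonneg (by positivity) (Finset.sum_nonneg fun l hl => ?_)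
        have hlk : l < k + 1 := Finset.mem_range.mp hl
        exact mul_nonneg (by positivity)
          (hP _ _ (ih l hlk) (ih (k - l) (by omega)) v)
  intro v
  have hτ0 : 0 ≤ τ := hτ.1
  have hsum : 0 ≤ ∑ k ∈ Finset.range (m + 1), τ ^ k * φ k v :=
    Finset.sum_nonneg fun k _ => mul_nonneg (pow_nonneg hτ0 k) (φ_nonneg k v)
  exact add_nonneg (mul_nonneg (sub_nonneg.mpr hτ.2) hsum)
    (mul_nonneg (pow_nonneg hτ0 _) (hfinf v))
end

section
/- Fourier transform of the truncated generalized X-ray transform: let f : ℝ³ → ℂ be integrable, let ω ∈ ℝ³ be a unit vector, and let R > 0. Define Φ_R(v) = ∫_{−R}^{R} |ρ| f(v + ρω) dρ. Then Φ_R is integrable and for every ξ ∈ ℝ³, ∫_{ℝ³} Φ_R(v) e^{i(v·ξ)} dv = (∫_{ℝ³} f(v) e^{i(v·ξ)} dv) · d_R(ξ·ω), where d_R(ζ) = ∫_{−R}^{R} |ρ| e^{−iρζ} dρ. -/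
open MeasureTheory intervalIntegral
open scoped RealInnerProductSpace

section Translates

variable {E : Type*} [NormedAddCommGroup E] [NormedSpace ℝ E] [MeasurableSpace E] [BorelSpace E]
  [SecondCountableTopology E] {ν : Measure E} [SFinite ν] [ν.IsAddRightInvariant]
  {μ : Measure ℝ} [SFinite μ] {f : E → ℂ} {g : ℝ → ℂ}

/-- A weighted family of translates of an integrable function along a line is jointly integrable
when the weight is integrable. -/
theorem integrable_prod_mul_translate (hf : Integrable f ν) (hg : Integrable g μ) (ω : E) :
    Integrable (fun p : ℝ × E => g p.1 * f (p.2 + p.1 • ω)) (μ.prod ν) := by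
  have hT : MeasurePreserving (fun p : ℝ × E => (p.1, p.2 + p.1 • ω)) (μ.prod ν) (μ.prod ν) :=
    (MeasurePreserving.id μ).skew_product (g := fun ρ v => v + ρ • ω)
      (Continuous.measurable (by fun_prop))
      (Filter.Eventually.of_forall fun ρ => map_add_right_eq_self ν (ρ • ω))
  exact hT.integrable_comp_of_integrable (hg.mul_prod hf)

theorem integrable_integral_mul_translate (hf : Integrable f ν) (hg : Integrable g μ) (ω : E) :
    Integrable (fun v => ∫ ρ, g ρ * f (v + ρ • ω) ∂μ) ν :=
  (integrable_prod_mul_translate hf hg ω).integral_prod_right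

theorem integral_integral_mul_translate (hf : Integrable f ν) (hg : Integrable g μ) (ω : E) :
    ∫ v, ∫ ρ, g ρ * f (v + ρ • ω) ∂μ ∂ν = (∫ v, f v ∂ν) * ∫ ρ, g ρ ∂μ := by
  rw [← integral_integral_swap (integrable_prod_mul_translate hf hg ω)]
  simp_rw [MeasureTheory.integral_const_mul, integral_add_right_eq_self f]
  rw [MeasureTheory.integral_mul_const, mul_comm]

end Translates

/-- **Fourier transform of the truncated generalized X-ray transform**: for integrable
`f : ℝ³ → ℂ`, a unit vector `ω` and `R > 0`, the transform
`Φ_R(v) = ∫_{−R}^{R} |ρ| f(v + ρω) dρ` is integrable and its Fourier transform satisfies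
`F[Φ_R](ξ) = F[f](ξ) · d_R(ξ·ω)` where `d_R(ζ) = ∫_{−R}^{R} |ρ| e^{−iρζ} dρ`. -/
theorem xray_transform_fourier
    (f : EuclideanSpace ℝ (Fin 3) → ℂ) (hf : Integrable f)
    (ω : EuclideanSpace ℝ (Fin 3)) (hω : ‖ω‖ = 1) (R : ℝ) (hR : 0 < R) :
    Integrable (fun v : EuclideanSpace ℝ (Fin 3) =>
      ∫ ρ : ℝ in (-R)..R, ((|ρ| : ℝ) : ℂ) * f (v + ρ • ω)) ∧
    ∀ ξ : EuclideanSpace ℝ (Fin 3),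
      (∫ v : EuclideanSpace ℝ (Fin 3),
          (∫ ρ : ℝ in (-R)..R, ((|ρ| : ℝ) : ℂ) * f (v + ρ • ω)) *
            Complex.exp (Complex.I * (⟪v, ξ⟫ : ℝ))) =
        (∫ v : EuclideanSpace ℝ (Fin 3), f v * Complex.exp (Complex.I * (⟪v, ξ⟫ : ℝ))) *
          ∫ ρ : ℝ in (-R)..R, ((|ρ| : ℝ) : ℂ) * Complex.exp (-Complex.I * ρ * (⟪ξ, ω⟫ : ℝ)) := by
  have hle : -R ≤ R := by linarith
  simp_rw [intervalIntegral.integral_of_le hle]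
  have integrable_weight {g : ℝ → ℂ} (hg : Continuous g) :
      Integrable g (volume.restrict (Set.Ioc (-R) R)) :=
    (hg.intervalIntegrable (-R) R).1
  refine ⟨integrable_integral_mul_translate hf (integrable_weight (by fun_prop)) ω, fun ξ => ?_⟩
  have hfe : Integrable fun v => f v * Complex.exp (Complex.I * (⟪v, ξ⟫ : ℝ)) := by
    refine hf.mul_bdd (c := 1) (Continuous.aestronglyMeasurable (by fun_prop))
      (Filter.Eventually.of_forall fun v => ?_)
    rw [mul_comm, Complex.norm_exp_ofReal_mul_I]
  rw [← integral_integral_mul_translate hfe (integrable_weight (by fun_prop)) ω]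
  refine MeasureTheory.integral_congr_ae (Filter.Eventually.of_forall fun v => ?_)
  simp only [← MeasureTheory.integral_mul_const]
  refine MeasureTheory.integral_congr_ae (Filter.Eventually.of_forall fun ρ => ?_)
  have hexp : Complex.exp (Complex.I * (⟪v, ξ⟫ : ℝ)) =
      Complex.exp (-Complex.I * ρ * (⟪ξ, ω⟫ : ℝ)) *
        Complex.exp (Complex.I * (⟪v + ρ • ω, ξ⟫ : ℝ)) := by
    rw [← Complex.exp_add, inner_add_left, real_inner_smul_left, real_inner_comm ξ ω]
    push_cast
    ring_nf
  simp only [hexp]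
  ring
end

section
/- Invariance of the kernel modes (Proposition 3.2 of Pareschi–Russo): let R₀ > 0 and let B : [0,∞) × [−1,1] → [0,∞) be measurable and bounded. Define for l, m ∈ ℝ³ the kernel mode B̂(l, m) = ∫_{B(0, 2R₀)} ∫_{S²} B(|g|, ω·g/|g|) exp(−i g·(l+m)/2 − i|g| ω·(m−l)/2) dω dg. Then B̂(l, m) depends only on |l + m|, |l − m| and (l + m)·(l − m): if l', m' ∈ ℝ³ satisfy |l' + m'| = |l + m|, |l' − m'| = |l − m| and (l' + m')·(l' − m') = (l + m)·(l − m), then B̂(l', m') = B̂(l, m). -/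
open MeasureTheory Metric
open scoped RealInnerProductSpace

noncomputable section

/-- The kernel mode
`B̂(l, m) = ∫_{B(0,2R₀)} ∫_{S²} B(|g|, ω·g/|g|) exp(−i g·(l+m)/2 − i |g| ω·(m−l)/2) dω dg`
of the Fourier–Galerkin discretization of the truncated Boltzmann collision operator. -/
def kernelMode (R0 : ℝ) (B : ℝ → ℝ → ℝ) (l m : EuclideanSpace ℝ (Fin 3)) : ℂ :=
  ∫ g in Metric.closedBall (0 : EuclideanSpace ℝ (Fin 3)) (2 * R0),
    ∫ ω : Metric.sphere (0 : EuclideanSpace ℝ (Fin 3)) 1,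
      (B ‖g‖ (⟪(ω : EuclideanSpace ℝ (Fin 3)), g⟫ / ‖g‖) : ℂ) *
        Complex.exp (-Complex.I * ((⟪g, l + m⟫ / 2 : ℝ) : ℂ) -
          Complex.I * ((‖g‖ * ⟪(ω : EuclideanSpace ℝ (Fin 3)), m - l⟫ / 2 : ℝ) : ℂ))
      ∂sphereMeasure

/-- Two pairs of vectors with the same norms and the same inner product are related by a linear
isometry. -/
theorem exists_linearIsometryEquiv_map_pair {F : Type*} [NormedAddCommGroup F]
    [InnerProductSpace ℝ F] {a b a' b' : F} (ha : ‖a'‖ = ‖a‖) (hb : ‖b'‖ = ‖b‖)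
    (hab : ⟪a', b'⟫ = ⟪a, b⟫) : ∃ Q : F ≃ₗᵢ[ℝ] F, Q a = a' ∧ Q b = b' := by
  set P := (ℝ ∙ (a - a'))ᗮ.reflection
  have hPa : P a = a' := Submodule.reflection_sub ha.symm
  have hfix : a' ∈ (ℝ ∙ (P b - b'))ᗮ := by
    rw [Submodule.mem_orthogonal_singleton_iff_inner_left, inner_sub_right, hab, ← hPa,
      P.inner_map_map, sub_self]
  refine ⟨P.trans (ℝ ∙ (P b - b'))ᗮ.reflection, ?_, ?_⟩
  · rw [LinearIsometryEquiv.trans_apply, hPa, Submodule.reflection_mem_subspace_eq_self hfix]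
  · exact Submodule.reflection_sub (by rw [P.norm_map, hb])

/-- The measurable automorphism of the unit sphere induced by a linear isometry. -/
def LinearIsometryEquiv.unitSphere {E : Type*} [NormedAddCommGroup E] [NormedSpace ℝ E]
    [MeasurableSpace E] [BorelSpace E] (Q : E ≃ₗᵢ[ℝ] E) :
    Metric.sphere (0 : E) 1 ≃ᵐ Metric.sphere (0 : E) 1 where
  toEquiv := Q.toEquiv.subtypeEquiv fun x => by simp
  measurable_toFun := (Q.continuous.measurable.comp measurable_subtype_coe).subtype_mk
  measurable_invFun := (Q.symm.continuous.measurable.comp measurable_subtype_coe).subtype_mk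

@[simp]
theorem LinearIsometryEquiv.coe_unitSphere_apply {E : Type*} [NormedAddCommGroup E]
    [NormedSpace ℝ E] [MeasurableSpace E] [BorelSpace E] (Q : E ≃ₗᵢ[ℝ] E)
    (ω : Metric.sphere (0 : E) 1) : (Q.unitSphere ω : E) = Q ω :=
  rfl

open scoped Pointwise in
/-- A linear isometry preserving a measure also preserves the induced measure on the sphere. -/
theorem LinearIsometryEquiv.measurePreserving_unitSphere {E : Type*} [NormedAddCommGroup E]
    [NormedSpace ℝ E] [MeasurableSpace E] [BorelSpace E] {μ : Measure E} (Q : E ≃ₗᵢ[ℝ] E)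
    (hQ : MeasurePreserving Q μ μ) :
    MeasurePreserving Q.unitSphere μ.toSphere μ.toSphere := by
  refine ⟨Q.unitSphere.measurable, Measure.ext fun s hs => ?_⟩
  rw [Q.unitSphere.map_apply, μ.toSphere_apply' hs,
    μ.toSphere_apply' (Q.unitSphere.measurable hs),
    ← hQ.measure_preimage_emb Q.toHomeomorph.measurableEmbedding
      (Set.Ioo (0 : ℝ) 1 • Set.image Subtype.val s)]
  congr 2
  ext x
  simp only [Set.mem_smul, Set.mem_image, Set.mem_preimage]
  constructor
  · rintro ⟨r, hr, _, ⟨ω, hω, rfl⟩, rfl⟩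
    exact ⟨r, hr, _, ⟨_, hω, rfl⟩, by simp⟩
  · rintro ⟨r, hr, _, ⟨ω, hω, rfl⟩, h⟩
    refine ⟨r, hr, _, ⟨Q.unitSphere.symm ω, by simpa using hω, rfl⟩, Q.injective ?_⟩
    rw [map_smul, ← Q.coe_unitSphere_apply, MeasurableEquiv.apply_symm_apply, h]

/-- **Invariance of the kernel modes** (Proposition 3.2 of Pareschi–Russo): the kernel
mode `B̂(l, m)` depends only on `|l + m|`, `|l − m|` and `(l + m)·(l − m)`. -/
theorem kernelMode_invariance
    (R0 : ℝ) (hR0 : 0 < R0) (B : ℝ → ℝ → ℝ)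
    (hBmeas : Measurable (Function.uncurry B))
    (hBbdd : ∃ C : ℝ, ∀ x y, B x y ≤ C) (hBnonneg : ∀ x y, 0 ≤ B x y)
    (l m l' m' : EuclideanSpace ℝ (Fin 3))
    (h1 : ‖l' + m'‖ = ‖l + m‖) (h2 : ‖l' - m'‖ = ‖l - m‖)
    (h3 : ⟪l' + m', l' - m'⟫ = ⟪l + m, l - m⟫) :
    kernelMode R0 B l' m' = kernelMode R0 B l m := by
  obtain ⟨Q, hQa, hQb⟩ := exists_linearIsometryEquiv_map_pair h1 h2 h3
  have hQb' : m' - l' = Q (m - l) := by rw [← neg_sub l m, map_neg, hQb, neg_sub]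
  have hball : Q ⁻¹' closedBall 0 (2 * R0) = closedBall 0 (2 * R0) := by
    rw [Q.preimage_closedBall, map_zero]
  unfold kernelMode
  rw [← Q.measurePreserving.setIntegral_preimage_emb Q.toHomeomorph.measurableEmbedding, hball]
  congr with g
  rw [sphereMeasure, ← (Q.measurePreserving_unitSphere Q.measurePreserving).integral_comp
    Q.unitSphere.measurableEmbedding]
  simp only [← hQa, hQb', Q.coe_unitSphere_apply, Q.inner_map_map, Q.norm_map]

end
end
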